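/- The epigraph of the set-valued return function V equals the viability kernel of H for φ: Epi(V) = Viab_φ(H), where Epi(V) = Graph(V + ℝ^p_+) = {(t,x,z) : t ∈ [0,T], x ∈ ℝ^n, z ∈ V(t,x) + ℝ^p_+}. -/

import Mathlib

open Pointwise MeasureTheory

/-- `FL^σ(x)`: the closure of the convex hull of `{(f(x,u), σ·L(x,u)) : u ∈ U}`. -/
def FLset {n m p : ℕ}
    (f : (Fin n → ℝ) → (Fin m → ℝ) → (Fin n → ℝ))
    (L : (Fin n → ℝ) → (Fin m → ℝ) → (Fin p → ℝ))
    (U : Set (Fin m → ℝ)) (σ : ℝ) (x : Fin n → ℝ) :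
    Set ((Fin n → ℝ) × (Fin p → ℝ)) :=
  closure (convexHull ℝ {q | ∃ u ∈ U, q = (f x u, σ • L x u)})

/-- The expanded set-valued map `φ`: `φ(t,x,z) = {1} × FL⁻(x)` if `t < T`, and
`φ(t,x,z) = [0,1] × cl(co(FL⁻(x) ∪ {(0,0)}))` if `t ≥ T`. -/
def phiMap {n p : ℕ} (T : ℝ)
    (FLm : (Fin n → ℝ) → Set ((Fin n → ℝ) × (Fin p → ℝ)))
    (q : ℝ × (Fin n → ℝ) × (Fin p → ℝ)) :
    Set (ℝ × ((Fin n → ℝ) × (Fin p → ℝ))) :=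
  if q.1 < T then {(1 : ℝ)} ×ˢ FLm q.2.1
  else Set.Icc (0 : ℝ) 1 ×ˢ closure (convexHull ℝ (FLm q.2.1 ∪ {0}))

/-- The nonnegative orthant `ℝ^p_+`. -/
def orthant (p : ℕ) : Set (Fin p → ℝ) := {z | ∀ i, 0 ≤ z i}

/-- The Pareto optimal set `E(S)` of `S ⊆ ℝ^p` (w.r.t. `ℝ^p_+`). -/
def paretoE {p : ℕ} (S : Set (Fin p → ℝ)) : Set (Fin p → ℝ) :=
  {y₁ | y₁ ∈ S ∧ ¬ ∃ y₂ ∈ S, y₂ ≠ y₁ ∧ y₁ - y₂ ∈ orthant p}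

/-- The objective space `Y(t,x)`: all costs `∫_t^T L(x(s;t,x,u),u(s)) ds` over
measurable controls `u` with values in `U`, where `x(·;t,x,u)` solves
`ẋ = f(x,u)` on `[t,T]` with `x(t) = x` (expressed via the integral equation). -/
def objSpace {n m p : ℕ}
    (f : (Fin n → ℝ) → (Fin m → ℝ) → (Fin n → ℝ))
    (L : (Fin n → ℝ) → (Fin m → ℝ) → (Fin p → ℝ))
    (U : Set (Fin m → ℝ)) (T : ℝ) (t : ℝ) (x : Fin n → ℝ) : Set (Fin p → ℝ) :=
  {y | ∃ (u : ℝ → Fin m → ℝ) (X : ℝ → Fin n → ℝ),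
    Measurable u ∧ (∀ s, u s ∈ U) ∧
    (∀ s ∈ Set.Icc t T, IntervalIntegrable (fun r => f (X r) (u r)) volume t s) ∧
    (∀ s ∈ Set.Icc t T, X s = x + ∫ r in t..s, f (X r) (u r)) ∧
    IntervalIntegrable (fun s => L (X s) (u s)) volume t T ∧
    y = ∫ s in t..T, L (X s) (u s)}

/-- The set-valued return function `V(t,x) = E(cl(Y(t,x)))`. -/
def returnFun {n m p : ℕ}
    (f : (Fin n → ℝ) → (Fin m → ℝ) → (Fin n → ℝ))
    (L : (Fin n → ℝ) → (Fin m → ℝ) → (Fin p → ℝ))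
    (U : Set (Fin m → ℝ)) (T : ℝ) (t : ℝ) (x : Fin n → ℝ) : Set (Fin p → ℝ) :=
  paretoE (closure (objSpace f L U T t x))

/-- The set `H = {(t,x,z) : t ∈ [0,T], z ∈ −(T−t)·M_L·𝟏 + ℝ^p_+}`. -/
def Hset (n p : ℕ) (T ML : ℝ) : Set (ℝ × (Fin n → ℝ) × (Fin p → ℝ)) :=
  {q | q.1 ∈ Set.Icc 0 T ∧ ∀ i, -(T - q.1) * ML ≤ q.2.2 i}

/-- The viability kernel `Viab_φ(H)`: points from which some solution of the
differential inclusion `(ṫ,ẋ,ż) ∈ φ(t,x,z)` (a.e. `s ≥ 0`) remains in `H` forever. -/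
def viabKernel {n p : ℕ}
    (φ : ℝ × (Fin n → ℝ) × (Fin p → ℝ) → Set (ℝ × ((Fin n → ℝ) × (Fin p → ℝ))))
    (H : Set (ℝ × (Fin n → ℝ) × (Fin p → ℝ))) :
    Set (ℝ × (Fin n → ℝ) × (Fin p → ℝ)) :=
  {q | ∃ y g : ℝ → ℝ × (Fin n → ℝ) × (Fin p → ℝ),
    y 0 = q ∧
    (∀ s : ℝ, 0 ≤ s → IntervalIntegrable g volume 0 s) ∧
    (∀ s : ℝ, 0 ≤ s → y s = q + ∫ r in (0:ℝ)..s, g r) ∧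
    (∀ᵐ s ∂(volume.restrict (Set.Ici (0:ℝ))), g s ∈ φ (y s)) ∧
    (∀ s : ℝ, 0 ≤ s → y s ∈ H)}

theorem IntervalIntegrable.mono_Icc {E : Type*} [NormedAddCommGroup E] {g : ℝ → E} {a b r s : ℝ}
    (hg : IntervalIntegrable g volume a b) (hr : r ∈ Set.Icc a b) (hs : s ∈ Set.Icc a b) :
    IntervalIntegrable g volume r s :=
  hg.mono_set (Set.uIcc_subset_uIcc (Set.Icc_subset_uIcc hr) (Set.Icc_subset_uIcc hs))

/-- A Lipschitz curve in a finite-dimensional space is the integral of its derivative. -/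
theorem LipschitzWith.integral_deriv_eq_sub {E : Type*} [NormedAddCommGroup E] [NormedSpace ℝ E]
    [FiniteDimensional ℝ E] {C : NNReal} {y : ℝ → E} (hy : LipschitzWith C y) (a b : ℝ) :
    IntervalIntegrable (deriv y) volume a b ∧ ∫ s in a..b, deriv y s = y b - y a := by
  have : CompleteSpace E := FiniteDimensional.complete ℝ E
  have hi : IntervalIntegrable (deriv y) volume a b := by
    refine (intervalIntegrable_const (c := (C : ℝ))).mono_fun
      (aestronglyMeasurable_deriv _ _) (Filter.Eventually.of_forall fun s => ?_)
    simpa using norm_deriv_le_of_lipschitz hy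
  refine ⟨hi, (SeparatingDual.eq_iff_forall_dual_eq (R := ℝ)).2 fun g => ?_⟩
  rw [← g.intervalIntegral_comp_comm hi, map_sub]
  have hg : LipschitzWith (‖g‖₊ * C) (g ∘ y) := g.lipschitz.comp hy
  have h := (hg.lipschitzOnWith (s := Set.uIcc a b)).absolutelyContinuousOnInterval
    |>.integral_deriv_eq_sub
  simp only [Function.comp_apply] at h
  rw [← h]
  refine intervalIntegral.integral_congr_ae ?_
  filter_upwards [hy.ae_differentiableAt_real] with s hs _
  exact ((g.hasFDerivAt.comp_hasDerivAt s hs.hasDerivAt).deriv).symm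

section Velocity

variable {E 𝒰 : Type*} [NormedAddCommGroup E] [NormedSpace ℝ E]

/-- The closed convex hull of the velocities available at `x`. -/
def velocitySet (F : E → 𝒰 → E) (U : Set 𝒰) (x : E) : Set E :=
  closure (convexHull ℝ (F x '' U))

variable {F : E → 𝒰 → E} {U : Set 𝒰} {K M : ℝ} {x : E}

theorem velocitySet_nonempty (hU : U.Nonempty) (x : E) : (velocitySet F U x).Nonempty :=
  (hU.image _).convexHull.closure

theorem norm_le_of_mem_velocitySet (hM : ∀ x, ∀ u ∈ U, ‖F x u‖ ≤ M) {w : E}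
    (hw : w ∈ velocitySet F U x) : ‖w‖ ≤ M := by
  have : velocitySet F U x ⊆ Metric.closedBall 0 M := by
    refine closure_minimal (convexHull_min ?_ (convex_closedBall _ _)) Metric.isClosed_closedBall
    rintro _ ⟨u, hu, rfl⟩
    simpa using hM x u hu
  simpa using this hw

theorem velocitySet_subset_cthickening
    (hK : ∀ u ∈ U, ∀ x y, ‖F x u - F y u‖ ≤ K * ‖x - y‖) {x y : E} {δ : ℝ}
    (hδ : K * ‖x - y‖ ≤ δ) :
    velocitySet F U x ⊆ Metric.cthickening δ (velocitySet F U y) := by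
  refine closure_minimal (convexHull_min ?_ ((convex_convexHull ℝ _).closure.cthickening _))
    Metric.isClosed_cthickening
  rintro _ ⟨u, hu, rfl⟩
  refine Metric.mem_cthickening_of_dist_le _ (F y u) _ _
    (subset_closure (subset_convexHull ℝ _ ⟨u, hu, rfl⟩)) ?_
  rw [dist_eq_norm]
  exact (hK u hu x y).trans hδ

/-- Averages of velocities taken close to `x₀` are close to the velocity set at `x₀`. -/
theorem infDist_average_le [CompleteSpace E] (hK0 : 0 ≤ K)
    (hK : ∀ u ∈ U, ∀ x y, ‖F x u - F y u‖ ≤ K * ‖x - y‖) {a b ρ : ℝ} (hab : a < b)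
    {w X : ℝ → E} {x₀ : E} (hi : IntervalIntegrable w volume a b)
    (hw : ∀ᵐ r, r ∈ Set.Ioc a b → w r ∈ velocitySet F U (X r))
    (hX : ∀ r ∈ Set.Ioc a b, ‖X r - x₀‖ ≤ ρ) :
    Metric.infDist ((b - a)⁻¹ • ∫ r in a..b, w r) (velocitySet F U x₀) ≤ K * ρ := by
  have hρ : 0 ≤ ρ := (norm_nonneg _).trans (hX b ⟨hab, le_rfl⟩)
  have h : (⨍ r in Set.Ioc a b, w r) ∈ Metric.cthickening (K * ρ) (velocitySet F U x₀) := by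
    refine Convex.set_average_mem ((convex_convexHull ℝ _).closure.cthickening _)
      Metric.isClosed_cthickening (by simp [hab]) (by simp) ?_
      ((intervalIntegrable_iff_integrableOn_Ioc_of_le hab.le).1 hi)
    rw [ae_restrict_iff' measurableSet_Ioc]
    filter_upwards [hw] with r hr hrab
    exact velocitySet_subset_cthickening hK
      (mul_le_mul_of_nonneg_left (hX r hrab) hK0) (hr hrab)
  rw [← interval_average_eq, Set.uIoc_of_le hab.le]
  exact ENNReal.toReal_le_of_le_ofReal (by positivity) (Metric.mem_cthickening_iff.1 h)

end Velocity

section Reach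

variable {E 𝒰 : Type*} [NormedAddCommGroup E] [NormedSpace ℝ E] [MeasurableSpace 𝒰]

/-- `X` is the Carathéodory trajectory on `[0, D]` of `ẋ = F(x, u)` from `x` driven by the
`U`-valued control `u`. -/
structure IsTrajectory (F : E → 𝒰 → E) (U : Set 𝒰) (D : ℝ) (x : E) (u : ℝ → 𝒰) (X : ℝ → E) :
    Prop where
  measurable : Measurable u
  mem : ∀ s, u s ∈ U
  integrable : IntervalIntegrable (fun r => F (X r) (u r)) volume 0 D
  eq : ∀ s ∈ Set.Icc 0 D, X s = x + ∫ r in (0:ℝ)..s, F (X r) (u r)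

/-- The points reachable from `x` at time `D` by trajectories of `ẋ = F(x, u)`. -/
def reach (F : E → 𝒰 → E) (U : Set 𝒰) (D : ℝ) (x : E) : Set E :=
  {y | ∃ u X, IsTrajectory F U D x u X ∧ X D = y}

variable {F : E → 𝒰 → E} {U : Set 𝒰} {D K M : ℝ} {x : E}

theorem IsTrajectory.sub_eq {u : ℝ → 𝒰} {X : ℝ → E} (h : IsTrajectory F U D x u X)
    {r s : ℝ} (hr : r ∈ Set.Icc 0 D) (hs : s ∈ Set.Icc 0 D) :
    X s - X r = ∫ q in r..s, F (X q) (u q) := by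
  have h0 : (0:ℝ) ∈ Set.Icc 0 D := ⟨le_rfl, hr.1.trans hr.2⟩
  rw [h.eq s hs, h.eq r hr, add_sub_add_left_eq_sub,
    intervalIntegral.integral_interval_sub_left (h.integrable.mono_Icc h0 hs)
      (h.integrable.mono_Icc h0 hr)]

theorem IsTrajectory.apply_zero {u : ℝ → 𝒰} {X : ℝ → E} (h : IsTrajectory F U D x u X)
    (hD : 0 ≤ D) : X 0 = x := by
  simpa using h.eq 0 ⟨le_rfl, hD⟩

theorem IsTrajectory.norm_sub_le {u : ℝ → 𝒰} {X : ℝ → E} (h : IsTrajectory F U D x u X)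
    (hM : ∀ x, ∀ u ∈ U, ‖F x u‖ ≤ M)
    {r s : ℝ} (hr : r ∈ Set.Icc 0 D) (hs : s ∈ Set.Icc 0 D) :
    ‖X s - X r‖ ≤ M * |s - r| := by
  rw [h.sub_eq hr hs]
  exact intervalIntegral.norm_integral_le_of_norm_le_const fun q _ => hM _ _ (h.mem q)

theorem norm_sub_le_of_mem_reach (hM : ∀ x, ∀ u ∈ U, ‖F x u‖ ≤ M) (hD : 0 ≤ D) {y : E}
    (hy : y ∈ reach F U D x) : ‖y - x‖ ≤ M * D := by
  obtain ⟨u, X, h, rfl⟩ := hy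
  have := h.norm_sub_le hM (r := 0) (s := D) ⟨le_rfl, hD⟩ ⟨hD, le_rfl⟩
  rwa [h.apply_zero hD, sub_zero, abs_of_nonneg hD] at this

theorem mem_reach_zero (hU : U.Nonempty) : x ∈ reach F U 0 x := by
  obtain ⟨u, hu⟩ := hU
  refine ⟨fun _ => u, fun _ => x, ⟨measurable_const, fun _ => hu, by simp, ?_⟩, rfl⟩
  rintro s ⟨h0, h1⟩
  simp [le_antisymm h1 h0]

/-- Trajectories can be concatenated. -/
theorem mem_reach_add {D₁ D₂ : ℝ} (h₁ : 0 ≤ D₁) (h₂ : 0 ≤ D₂) {y z : E}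
    (hy : y ∈ reach F U D₁ x) (hz : z ∈ reach F U D₂ y) : z ∈ reach F U (D₁ + D₂) x := by
  obtain ⟨u₁, X₁, t₁, rfl⟩ := hy
  obtain ⟨u₂, X₂, t₂, rfl⟩ := hz
  set u : ℝ → 𝒰 := fun r => if r ≤ D₁ then u₁ r else u₂ (r - D₁) with hu
  set X : ℝ → E := fun r => if r ≤ D₁ then X₁ r else X₂ (r - D₁) with hX
  have e₁ : ∀ r, r ≤ D₁ → F (X₁ r) (u₁ r) = F (X r) (u r) := fun r hr => by simp [hu, hX, hr]
  have e₂ : ∀ r, D₁ < r → F (X₂ (r - D₁)) (u₂ (r - D₁)) = F (X r) (u r) := fun r hr => by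
    simp [hu, hX, not_le.2 hr]
  have i₁ : IntervalIntegrable (fun r => F (X r) (u r)) volume 0 D₁ :=
    t₁.integrable.congr fun r hr => e₁ r (by rw [Set.uIoc_of_le h₁] at hr; exact hr.2)
  have i₂ : IntervalIntegrable (fun r => F (X r) (u r)) volume D₁ (D₁ + D₂) := by
    have := t₂.integrable.comp_sub_right D₁
    rw [zero_add, add_comm D₂] at this
    exact this.congr fun r hr => e₂ r (by rw [Set.uIoc_of_le (by linarith)] at hr; exact hr.1)
  have v₁ : ∀ s ∈ Set.Icc 0 D₁, X s = x + ∫ r in (0:ℝ)..s, F (X r) (u r) := by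
    intro s hs
    have : X s = X₁ s := by simp [hX, hs.2]
    rw [this, t₁.eq s hs]
    congr 1
    refine intervalIntegral.integral_congr fun r hr => e₁ r ?_
    rw [Set.uIcc_of_le hs.1] at hr
    exact hr.2.trans hs.2
  refine ⟨u, X, ⟨?_, ?_, i₁.trans i₂, ?_⟩, ?_⟩
  · exact Measurable.ite measurableSet_Iic t₁.measurable
      (t₂.measurable.comp (measurable_id.sub_const D₁))
  · intro s
    simp only [hu]
    split_ifs
    exacts [t₁.mem _, t₂.mem _]
  · intro s hs
    rcases le_or_gt s D₁ with h | h
    · exact v₁ s ⟨hs.1, h⟩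
    · have hs' : s - D₁ ∈ Set.Icc 0 D₂ := ⟨by linarith, by linarith [hs.2]⟩
      rw [← intervalIntegral.integral_add_adjacent_intervals i₁
        (i₂.mono_Icc ⟨le_rfl, by linarith⟩ ⟨h.le, hs.2⟩), ← add_assoc, ← v₁ D₁ ⟨h₁, le_rfl⟩]
      have a₁ : X D₁ = X₁ D₁ := by simp [hX]
      have a₂ : X s = X₂ (s - D₁) := by simp [hX, not_le.2 h]
      rw [a₁, a₂, t₂.eq _ hs']
      congr 1
      have := intervalIntegral.integral_comp_sub_right (a := D₁) (b := s)
        (fun r => F (X₂ r) (u₂ r)) D₁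
      rw [sub_self] at this
      rw [← this]
      refine intervalIntegral.integral_congr_ae (Filter.Eventually.of_forall fun r hr => e₂ r ?_)
      rw [Set.uIoc_of_le h.le] at hr
      exact hr.1
  · rcases h₂.eq_or_lt with h | h
    · subst h
      simp only [hX, add_zero, le_refl, if_true]
      exact (t₂.apply_zero le_rfl).symm
    · simp [hX, h]

/-- Constant controls: near `x₀` the trajectory is well approximated by the velocity frozen at
`x₀`. -/
theorem exists_mem_reach_const [CompleteSpace E] (hK0 : 0 ≤ K) (hM0 : 0 ≤ M)
    (hK : ∀ u ∈ U, ∀ x y, ‖F x u - F y u‖ ≤ K * ‖x - y‖) (hM : ∀ x, ∀ u ∈ U, ‖F x u‖ ≤ M)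
    {u : 𝒰} (hu : u ∈ U) (hD : 0 ≤ D) (x x₀ : E) :
    ∃ y ∈ reach F U D x, ‖y - x - D • F x₀ u‖ ≤ D * K * (‖x - x₀‖ + M * D) := by
  have hl : LipschitzWith ⟨K, hK0⟩ (fun x => F x u) :=
    LipschitzWith.of_dist_le_mul fun a b => by
      rw [dist_eq_norm, dist_eq_norm]
      exact hK u hu a b
  have pl : IsPicardLindelof (fun _ : ℝ => fun x => F x u) (tmin := 0) (tmax := D)
      ⟨0, le_rfl, hD⟩ x ⟨M * D, by positivity⟩ 0 ⟨M, hM0⟩ ⟨K, hK0⟩ :=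
    .of_time_independent (fun y _ => hM y u hu) hl.lipschitzOnWith (by
      change M * max (D - 0) (0 - 0) ≤ M * D - 0
      simp [hD])
  obtain ⟨X, hX0, hX⟩ := pl.exists_eq_forall_mem_Icc_hasDerivWithinAt₀
  simp only at hX0
  have hXc : ContinuousOn X (Set.Icc 0 D) := fun s hs => (hX s hs).continuousWithinAt
  have hFc : ContinuousOn (fun s => F (X s) u) (Set.Icc 0 D) := hl.continuous.comp_continuousOn hXc
  have hi : IntervalIntegrable (fun s => F (X s) u) volume 0 D :=
    ContinuousOn.intervalIntegrable (by rwa [Set.uIcc_of_le hD])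
  have ht : IsTrajectory F U D x (fun _ => u) X := by
    refine ⟨measurable_const, fun _ => hu, hi, fun s hs => ?_⟩
    have hsub : Set.Icc 0 s ⊆ Set.Icc 0 D := Set.Icc_subset_Icc_right hs.2
    rw [intervalIntegral.integral_eq_sub_of_hasDerivAt_of_le hs.1 (hXc.mono hsub)
      (fun r hr => (hX r ⟨hr.1.le, hr.2.le.trans hs.2⟩).hasDerivAt
        (Icc_mem_nhds hr.1 (hr.2.trans_le hs.2)))
      (hi.mono_Icc ⟨le_rfl, hD⟩ hs), hX0]
    abel
  refine ⟨X D, ⟨_, X, ht, rfl⟩, ?_⟩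
  have h1 : X D - x - D • F x₀ u = ∫ s in (0:ℝ)..D, (F (X s) u - F x₀ u) := by
    rw [intervalIntegral.integral_sub hi (by simp), intervalIntegral.integral_const, sub_zero,
      ← ht.sub_eq ⟨le_rfl, hD⟩ ⟨hD, le_rfl⟩, hX0]
  have h2 : ∀ s ∈ Set.uIoc 0 D, ‖F (X s) u - F x₀ u‖ ≤ K * (‖x - x₀‖ + M * D) := by
    intro s hs
    rw [Set.uIoc_of_le hD] at hs
    have h3 := ht.norm_sub_le hM (r := 0) (s := s) ⟨le_rfl, hD⟩ ⟨hs.1.le, hs.2⟩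
    rw [hX0, sub_zero, abs_of_pos hs.1] at h3
    have h4 : ‖X s - x₀‖ ≤ ‖X s - x‖ + ‖x - x₀‖ := norm_sub_le_norm_sub_add_norm_sub ..
    have h5 : M * s ≤ M * D := mul_le_mul_of_nonneg_left hs.2 hM0
    exact (hK u hu _ _).trans (mul_le_mul_of_nonneg_left (by linarith) hK0)
  rw [h1]
  refine (intervalIntegral.norm_integral_le_of_norm_le_const h2).trans_eq ?_
  rw [sub_zero, abs_of_nonneg hD]
  ring

/-- Convex combinations of velocities frozen at `x₀` are realised, up to second order, by
trajectories that switch between constant controls. -/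
theorem exists_mem_reach_convexHull [CompleteSpace E] (hK0 : 0 ≤ K) (hM0 : 0 ≤ M)
    (hK : ∀ u ∈ U, ∀ x y, ‖F x u - F y u‖ ≤ K * ‖x - y‖) (hM : ∀ x, ∀ u ∈ U, ‖F x u‖ ≤ M)
    {x₀ w : E} (hw : w ∈ convexHull ℝ (F x₀ '' U)) (hD : 0 ≤ D) (x : E) :
    ∃ y ∈ reach F U D x, ‖y - x - D • w‖ ≤ D * K * (‖x - x₀‖ + M * D) := by
  suffices h : convexHull ℝ (F x₀ '' U) ⊆ {w | ∀ D, 0 ≤ D → ∀ x, ∃ y ∈ reach F U D x,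
      ‖y - x - D • w‖ ≤ D * K * (‖x - x₀‖ + M * D)} from h hw D hD x
  refine convexHull_min ?_ ?_
  · rintro _ ⟨u, hu, rfl⟩ D hD x
    exact exists_mem_reach_const hK0 hM0 hK hM hu hD x x₀
  · intro w₁ hw₁ w₂ hw₂ a b ha hb hab D hD x
    have haD : 0 ≤ a * D := by positivity
    have hbD : 0 ≤ b * D := by positivity
    obtain ⟨y, hy, ey⟩ := hw₁ (a * D) haD x
    obtain ⟨z, hz, ez⟩ := hw₂ (b * D) hbD y
    have hsum : a * D + b * D = D := by rw [← add_mul, hab, one_mul]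
    refine ⟨z, hsum ▸ mem_reach_add haD hbD hy hz, ?_⟩
    have hxy := norm_sub_le_of_mem_reach hM haD hy
    have hyx : ‖y - x₀‖ ≤ ‖y - x‖ + ‖x - x₀‖ := norm_sub_le_norm_sub_add_norm_sub ..
    have e : z - x - D • (a • w₁ + b • w₂)
        = (y - x - (a * D) • w₁) + (z - y - (b * D) • w₂) := by
      rw [smul_add, smul_smul, smul_smul, mul_comm D a, mul_comm D b]
      abel
    rw [e]
    have ez' : b * D * K * (‖y - x₀‖ + M * (b * D)) ≤
        b * D * K * (‖x - x₀‖ + M * D) := by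
      refine mul_le_mul_of_nonneg_left ?_ (by positivity)
      have : M * (a * D) + M * (b * D) = M * D := by rw [← mul_add, hsum]
      linarith
    have ey' : a * D * K * (‖x - x₀‖ + M * (a * D)) ≤
        a * D * K * (‖x - x₀‖ + M * D) := by
      refine mul_le_mul_of_nonneg_left ?_ (by positivity)
      have : M * (a * D) ≤ M * D := mul_le_mul_of_nonneg_left (by linarith) hM0
      linarith
    calc _ ≤ _ := norm_add_le _ _
      _ ≤ a * D * K * (‖x - x₀‖ + M * D) + b * D * K * (‖x - x₀‖ + M * D) := by linarith
      _ = (a * D + b * D) * K * (‖x - x₀‖ + M * D) := by ring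
      _ = _ := by rw [hsum]

section Relaxation

variable [CompleteSpace E] (hU : U.Nonempty) (hK0 : 0 ≤ K) (hM0 : 0 ≤ M)
  (hK : ∀ u ∈ U, ∀ x y, ‖F x u - F y u‖ ≤ K * ‖x - y‖) (hM : ∀ x, ∀ u ∈ U, ‖F x u‖ ≤ M)
  {y w : ℝ → E}

include hU hK0 hM0 hK hM

theorem exists_mem_reach_step {s h : ℝ} (hh : 0 < h)
    (hy : ∀ r ∈ Set.Icc s (s + h), y r = y s + ∫ q in s..r, w q)
    (hi : IntervalIntegrable w volume s (s + h))
    (hw : ∀ᵐ r, r ∈ Set.Ioc s (s + h) → w r ∈ velocitySet F U (y r)) (Y : E) :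
    ∃ Z ∈ reach F U h Y,
      ‖Z - y (s + h)‖ ≤ (1 + K * h) * ‖Y - y s‖ + (2 * K * M + 1) * h ^ 2 := by
  have hsh : s < s + h := by linarith
  have hρ : ∀ r ∈ Set.Ioc s (s + h), ‖y r - y s‖ ≤ M * h := by
    intro r hr
    rw [hy r ⟨hr.1.le, hr.2⟩, add_sub_cancel_left]
    have h1 : ‖∫ q in s..r, w q‖ ≤ M * |r - s| := by
      refine intervalIntegral.norm_integral_le_of_norm_le_const_ae ?_
      filter_upwards [hw] with q hq hqr
      rw [Set.uIoc_of_le hr.1.le] at hqr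
      exact norm_le_of_mem_velocitySet hM (hq ⟨hqr.1, hqr.2.trans hr.2⟩)
    rw [abs_of_pos (by linarith [hr.1])] at h1
    exact h1.trans (mul_le_mul_of_nonneg_left (by linarith [hr.2]) hM0)
  have hd := infDist_average_le hK0 hK hsh hi hw hρ
  rw [add_sub_cancel_left, velocitySet, Metric.infDist_closure] at hd
  have hd' := hd.trans_lt (lt_add_of_pos_right (K * (M * h)) hh)
  obtain ⟨v, hv, hvd⟩ := (Metric.infDist_lt_iff (hU.image _).convexHull).1 hd'
  obtain ⟨Z, hZ, eZ⟩ := exists_mem_reach_convexHull hK0 hM0 hK hM hv hh.le Y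
  refine ⟨Z, hZ, ?_⟩
  have e : Z - y (s + h) = (Z - Y - h • v) + (Y - y s)
      - h • (h⁻¹ • (∫ q in s..s + h, w q) - v) := by
    rw [smul_sub, smul_inv_smul₀ hh.ne', hy (s + h) ⟨hsh.le, le_rfl⟩]
    abel
  rw [dist_eq_norm] at hvd
  have h2 : ‖h • (h⁻¹ • (∫ q in s..s + h, w q) - v)‖ ≤ h * (K * (M * h) + h) := by
    rw [norm_smul, Real.norm_of_nonneg hh.le]
    exact mul_le_mul_of_nonneg_left hvd.le hh.le
  rw [e]
  calc _ ≤ ‖Z - Y - h • v‖ + ‖Y - y s‖ + ‖h • (h⁻¹ • (∫ q in s..s + h, w q) - v)‖ :=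
        (norm_sub_le _ _).trans (by gcongr; exact norm_add_le _ _)
    _ ≤ h * K * (‖Y - y s‖ + M * h) + ‖Y - y s‖ + h * (K * (M * h) + h) := by gcongr
    _ = _ := by ring

/-- Relaxation: solutions of the convexified inclusion are limits of controlled trajectories. -/
theorem mem_closure_reach (hD : 0 ≤ D) (hi : IntervalIntegrable w volume 0 D)
    (hy : ∀ s ∈ Set.Icc 0 D, y s = x + ∫ r in (0:ℝ)..s, w r)
    (hw : ∀ᵐ s, s ∈ Set.Ioc 0 D → w s ∈ velocitySet F U (y s)) :
    y D ∈ closure (reach F U D x) := by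
  have hy0 : y 0 = x := by simpa using hy 0 ⟨le_rfl, hD⟩
  rcases hD.eq_or_lt with rfl | hD'
  · rw [hy0]
    exact subset_closure (mem_reach_zero hU)
  set C : ℝ := 2 * K * M + 1 with hC
  have hC0 : 0 ≤ C := by positivity
  have euler : ∀ h, 0 < h → ∀ k : ℕ, k * h ≤ D →
      ∃ Y ∈ reach F U (k * h) x,
        ‖Y - y (k * h)‖ ≤ k * (C * h ^ 2) * Real.exp (K * (k * h)) := by
    intro h hh k
    induction k with
    | zero =>
      intro _
      exact ⟨x, by simpa using mem_reach_zero hU, by simp [hy0]⟩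
    | succ k ih =>
      intro hk
      push_cast at hk
      have hkh : 0 ≤ k * h := by positivity
      have e : ((k + 1 : ℕ) : ℝ) * h = k * h + h := by push_cast; ring
      obtain ⟨Y, hY, eY⟩ := ih (by linarith)
      have hs : k * h ∈ Set.Icc 0 D := ⟨hkh, by linarith⟩
      have hs' : k * h + h ∈ Set.Icc 0 D := ⟨by linarith, by linarith⟩
      obtain ⟨Z, hZ, eZ⟩ := exists_mem_reach_step hU hK0 hM0 hK hM (y := y) (w := w) hh
        (s := k * h) (fun r hr => by
          have hr' : r ∈ Set.Icc 0 D := ⟨hkh.trans hr.1, hr.2.trans hs'.2⟩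
          rw [hy r hr', hy _ hs, add_assoc, intervalIntegral.integral_add_adjacent_intervals
            (hi.mono_Icc ⟨le_rfl, hD⟩ hs) (hi.mono_Icc hs hr')])
        (hi.mono_Icc hs hs')
        (by filter_upwards [hw] with r hr hr' using hr ⟨hkh.trans_lt hr'.1, hr'.2.trans hs'.2⟩) Y
      refine ⟨Z, e ▸ mem_reach_add hkh hh.le hY hZ, ?_⟩
      rw [e]
      have hA : 0 ≤ C * h ^ 2 := by positivity
      have e1 : 1 + K * h ≤ Real.exp (K * h) := by linarith [Real.add_one_le_exp (K * h)]
      have e2 : 1 ≤ Real.exp (K * (k * h + h)) := Real.one_le_exp (by positivity)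
      have e3 : Real.exp (K * (k * h + h)) = Real.exp (K * h) * Real.exp (K * (k * h)) := by
        rw [← Real.exp_add]
        ring_nf
      calc _ ≤ _ := eZ
        _ ≤ Real.exp (K * h) * (k * (C * h ^ 2) * Real.exp (K * (k * h))) + C * h ^ 2 * 1 := by
          rw [mul_one]
          gcongr
        _ = k * (C * h ^ 2) * Real.exp (K * (k * h + h)) + C * h ^ 2 * 1 := by rw [e3]; ring
        _ ≤ k * (C * h ^ 2) * Real.exp (K * (k * h + h))
            + C * h ^ 2 * Real.exp (K * (k * h + h)) := by gcongr
        _ = _ := by push_cast; ring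
  rw [Metric.mem_closure_iff]
  intro ε hε
  obtain ⟨N, hN⟩ := exists_nat_gt (C * D ^ 2 * Real.exp (K * D) / ε)
  have hN0 : (0:ℝ) < N := lt_of_le_of_lt (by positivity) hN
  have hND : (N:ℝ) * (D / N) = D := mul_div_cancel₀ _ hN0.ne'
  obtain ⟨Y, hY, eY⟩ := euler (D / N) (by positivity) N hND.le
  rw [hND] at hY eY
  refine ⟨Y, hY, ?_⟩
  rw [dist_comm, dist_eq_norm]
  refine eY.trans_lt ?_
  rw [div_lt_iff₀ hε] at hN
  have : (N:ℝ) * (C * (D / N) ^ 2) * Real.exp (K * D) = C * D ^ 2 * Real.exp (K * D) / N := by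
    field_simp
  rw [this, div_lt_iff₀ hN0]
  linarith

end Relaxation

/-- Compactness: limits of reachable points are reached by solutions of the convexified
inclusion. -/
theorem exists_relaxed_trajectory [FiniteDimensional ℝ E] (hU : U.Nonempty) (hK0 : 0 ≤ K)
    (hM0 : 0 ≤ M) (hK : ∀ u ∈ U, ∀ x y, ‖F x u - F y u‖ ≤ K * ‖x - y‖)
    (hM : ∀ x, ∀ u ∈ U, ‖F x u‖ ≤ M) (hD : 0 ≤ D) {v : E} (hv : v ∈ closure (reach F U D x)) :
    ∃ Y : ℝ → E, LipschitzWith ⟨M, hM0⟩ Y ∧ Y 0 = x ∧ (∀ s, D ≤ s → Y s = v) ∧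
      ∀ᵐ s, s ∈ Set.Ioo 0 D → deriv Y s ∈ velocitySet F U (Y s) := by
  have : CompleteSpace E := FiniteDimensional.complete ℝ E
  have : ProperSpace E := FiniteDimensional.proper ℝ E
  obtain ⟨b, hb, hbv⟩ := mem_closure_iff_seq_limit.1 hv
  choose u X hX hXD using hb
  set 𝒢 : Filter ℕ := (Filter.hyperfilter ℕ : Filter ℕ) with h𝒢
  have h𝒢t : 𝒢 ≤ Filter.atTop := Nat.hyperfilter_le_atTop
  set c : ℝ → ℝ := fun s => Set.projIcc 0 D hD s with hc
  have hcm : ∀ s, c s ∈ Set.Icc 0 D := fun s => (Set.projIcc 0 D hD s).2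
  have hcid : ∀ s ∈ Set.Icc 0 D, c s = s := fun s hs => by
    simp [hc, Set.projIcc_of_mem hD hs]
  have hc1 : ∀ r s, |c s - c r| ≤ |s - r| := fun r s => by
    have := (LipschitzWith.projIcc hD).dist_le_mul s r
    simpa [Subtype.dist_eq, Real.dist_eq] using this
  have hlip : ∀ j r s, ‖X j (c s) - X j (c r)‖ ≤ M * |s - r| := fun j r s =>
    ((hX j).norm_sub_le hM (hcm r) (hcm s)).trans (mul_le_mul_of_nonneg_left (hc1 r s) hM0)
  have hlim : ∀ s, ∃ z, Filter.Tendsto (fun j => X j (c s)) 𝒢 (nhds z) := by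
    intro s
    obtain ⟨z, -, hz⟩ := isCompact_iff_ultrafilter_le_nhds.1
      (isCompact_closedBall x (M * |s|))
      ((Filter.hyperfilter ℕ).map fun j => X j (c s)) (by
        rw [Ultrafilter.coe_map, Filter.le_principal_iff]
        refine Filter.mem_map.2 (Filter.univ_mem' fun j => ?_)
        rw [Set.mem_preimage, Metric.mem_closedBall, dist_eq_norm]
        simpa [hcid 0 ⟨le_rfl, hD⟩, (hX j).apply_zero hD] using hlip j 0 s)
    exact ⟨z, hz⟩
  choose Y hY using hlim
  have hY0 : Y 0 = x := by
    refine tendsto_nhds_unique (hY 0) (tendsto_const_nhds.congr fun j => ?_)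
    rw [hcid 0 ⟨le_rfl, hD⟩, (hX j).apply_zero hD]
  have hYD : ∀ s, D ≤ s → Y s = v := by
    intro s hs
    refine tendsto_nhds_unique (hY s) ((hbv.mono_left h𝒢t).congr fun j => ?_)
    rw [← hXD j]
    simp [hc, Set.projIcc_of_right_le hD hs]
  have hYL : LipschitzWith ⟨M, hM0⟩ Y := by
    refine LipschitzWith.of_dist_le_mul fun s r => ?_
    rw [dist_eq_norm]
    exact le_of_tendsto ((hY s).sub (hY r)).norm (Filter.Eventually.of_forall fun j => hlip j r s)
  refine ⟨Y, hYL, hY0, hYD, ?_⟩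
  have hquot : ∀ s h, 0 < h → s ∈ Set.Icc 0 D → s + h ∈ Set.Icc 0 D →
      Metric.infDist (h⁻¹ • (Y (s + h) - Y s)) (velocitySet F U (Y s)) ≤ K * (M * h) := by
    intro s h hh hs hsh
    have hlt : s < s + h := by linarith
    have hj : ∀ j, Metric.infDist (h⁻¹ • (X j (c (s + h)) - X j (c s))) (velocitySet F U (Y s))
        ≤ K * (M * h + ‖X j (c s) - Y s‖) := by
      intro j
      rw [hcid s hs, hcid _ hsh, (hX j).sub_eq hs hsh]
      have := infDist_average_le (F := F) (U := U) (X := X j) (x₀ := Y s)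
        (ρ := M * h + ‖X j s - Y s‖) hK0 hK hlt ((hX j).integrable.mono_Icc hs hsh)
        (Filter.Eventually.of_forall fun r _ => subset_closure (subset_convexHull ℝ _
          ⟨u j r, (hX j).mem r, rfl⟩))
        (fun r hr => by
          have hr' : r ∈ Set.Icc 0 D := ⟨hs.1.trans hr.1.le, hr.2.trans hsh.2⟩
          have h1 := (hX j).norm_sub_le hM hs hr'
          rw [abs_of_pos (by linarith [hr.1])] at h1
          have h2 : M * (r - s) ≤ M * h := mul_le_mul_of_nonneg_left (by linarith [hr.2]) hM0
          have h3 : ‖X j r - Y s‖ ≤ ‖X j r - X j s‖ + ‖X j s - Y s‖ :=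
            norm_sub_le_norm_sub_add_norm_sub ..
          linarith)
      rwa [add_sub_cancel_left] at this
    have h1 := ((Metric.continuous_infDist_pt (velocitySet F U (Y s))).tendsto _).comp
      (((hY (s + h)).sub (hY s)).const_smul h⁻¹)
    have h2 := ((((hY s).sub_const (Y s)).norm).const_add (M * h)).const_mul K
    rw [sub_self, norm_zero, add_zero] at h2
    exact le_of_tendsto_of_tendsto' h1 h2 hj
  filter_upwards [hYL.ae_differentiableAt_real] with s hs hsD
  have h1 := ((Metric.continuous_infDist_pt (velocitySet F U (Y s))).tendsto _).comp
    hs.hasDerivAt.tendsto_slope_zero_right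
  have h2 : Filter.Tendsto (fun h => K * (M * h)) (nhdsWithin 0 (Set.Ioi 0)) (nhds 0) := by
    have : Filter.Tendsto (fun h => K * (M * h)) (nhds 0) (nhds (K * (M * 0))) :=
      (continuous_const.mul (continuous_const.mul continuous_id)).tendsto 0
    rw [mul_zero, mul_zero] at this
    exact this.mono_left nhdsWithin_le_nhds
  have h3 : Metric.infDist (deriv Y s) (velocitySet F U (Y s)) ≤ 0 := by
    refine le_of_tendsto_of_tendsto h1 h2 ?_
    filter_upwards [Ioo_mem_nhdsGT (sub_pos.2 hsD.2)] with h hh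
    exact hquot s h hh.1 (Set.Ioo_subset_Icc_self hsD)
      ⟨by linarith [hsD.1, hh.1], by linarith [hh.2]⟩
  exact (isClosed_closure.mem_iff_infDist_zero (velocitySet_nonempty hU _)).2
    (le_antisymm h3 Metric.infDist_nonneg)

end Reach

theorem IntervalIntegrable.prodMk {E E' : Type*} [NormedAddCommGroup E] [NormedAddCommGroup E']
    {g : ℝ → E} {k : ℝ → E'} {a b : ℝ} (hg : IntervalIntegrable g volume a b)
    (hk : IntervalIntegrable k volume a b) :
    IntervalIntegrable (fun r => (g r, k r)) volume a b :=
  ⟨Integrable.prodMk hg.1 hk.1, Integrable.prodMk hg.2 hk.2⟩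

/-- Every point of a compact set dominates a Pareto optimal one. -/
theorem exists_paretoE_le {p : ℕ} {S : Set (Fin p → ℝ)} (hS : IsCompact S) {c : Fin p → ℝ}
    (hc : c ∈ S) : ∃ v ∈ paretoE S, ∀ i, v i ≤ c i := by
  obtain ⟨v, ⟨hvS, hvc⟩, hv⟩ := (hS.inter_right isClosed_Iic).exists_isMinOn
    ⟨c, hc, le_refl c⟩ (f := fun z : Fin p → ℝ => ∑ i, z i)
    (continuous_finsetSum _ fun i _ => continuous_apply i).continuousOn
  refine ⟨v, ⟨hvS, ?_⟩, hvc⟩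
  rintro ⟨y, hyS, hne, hy⟩
  have hle : y ≤ v := fun i => sub_nonneg.1 (hy i)
  obtain ⟨i, hi⟩ : ∃ i, y i < v i := by
    by_contra! h
    exact hne (le_antisymm hle h)
  exact (Finset.sum_lt_sum (fun i _ => hle i) ⟨i, Finset.mem_univ i, hi⟩).not_ge
    (hv ⟨hyS, hle.trans hvc⟩)

section Augmented

variable {n m p : ℕ}

/-- The dynamics augmented by the negative running cost. -/
def augmented (f : (Fin n → ℝ) → (Fin m → ℝ) → (Fin n → ℝ))
    (L : (Fin n → ℝ) → (Fin m → ℝ) → (Fin p → ℝ)) (q : (Fin n → ℝ) × (Fin p → ℝ))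
    (u : Fin m → ℝ) : (Fin n → ℝ) × (Fin p → ℝ) :=
  (f q.1 u, -L q.1 u)

variable {f : (Fin n → ℝ) → (Fin m → ℝ) → (Fin n → ℝ)}
  {L : (Fin n → ℝ) → (Fin m → ℝ) → (Fin p → ℝ)} {U : Set (Fin m → ℝ)} {T t ML : ℝ}

theorem velocitySet_augmented (q : (Fin n → ℝ) × (Fin p → ℝ)) :
    velocitySet (augmented f L) U q = FLset f L U (-1) q.1 := by
  unfold velocitySet FLset augmented
  congr 2
  ext w
  simp [eq_comm]

theorem norm_snd_le_of_mem_FLset (hLBdd : ∀ x, ∀ u ∈ U, ‖L x u‖ ≤ ML) {x : Fin n → ℝ}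
    {w : (Fin n → ℝ) × (Fin p → ℝ)} (hw : w ∈ FLset f L U (-1) x) : ‖w.2‖ ≤ ML := by
  have h : FLset f L U (-1) x ⊆ Prod.snd ⁻¹' Metric.closedBall 0 ML := by
    refine closure_minimal (convexHull_min ?_ ?_)
      (Metric.isClosed_closedBall.preimage continuous_snd)
    · rintro _ ⟨u, hu, rfl⟩
      simpa using hLBdd x u hu
    · exact (convex_closedBall (0 : Fin p → ℝ) ML).linear_preimage
        (LinearMap.snd ℝ (Fin n → ℝ) (Fin p → ℝ))
  simpa using h hw

/-- The objective space is read off from the reachable set of the augmented dynamics. -/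
theorem objSpace_eq_image_reach (htT : t ≤ T) (x : Fin n → ℝ) (z : Fin p → ℝ) :
    objSpace f L U T t x = (fun q => z - q.2) '' reach (augmented f L) U (T - t) (x, z) := by
  ext c
  constructor
  · rintro ⟨u, X, hu, huU, hfi, hX, hLi, rfl⟩
    have hfT := hfi T ⟨htT, le_rfl⟩
    have hi : ∀ s ∈ Set.Icc t T, ∀ r ∈ Set.Icc t T,
        IntervalIntegrable (fun r => augmented f L (X r, 0) (u r)) volume r s := fun s hs r hr =>
      (hfT.prodMk hLi.neg).mono_Icc hr hs
    set Z : ℝ → (Fin n → ℝ) × (Fin p → ℝ) :=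
      fun s => (X (s + t), z - ∫ r in t..(s + t), L (X r) (u r)) with hZ
    have e : (fun r => augmented f L (Z r) (u (r + t)))
        = fun r => (fun r => augmented f L (X r, 0) (u r)) (r + t) := rfl
    refine ⟨Z (T - t), ⟨fun s => u (s + t), Z, ⟨hu.comp (measurable_id.add_const t),
      fun s => huU _, ?_, ?_⟩, rfl⟩, by simp [hZ]⟩
    · have := (hi T ⟨htT, le_rfl⟩ t ⟨le_rfl, htT⟩).comp_add_right t
      rwa [sub_self] at this
    · intro s hs
      have hst : s + t ∈ Set.Icc t T := ⟨by linarith [hs.1], by linarith [hs.2]⟩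
      rw [e, intervalIntegral.integral_comp_add_right
        (fun r => augmented f L (X r, 0) (u r)) t, zero_add]
      have hi' := hi _ hst t ⟨le_rfl, htT⟩
      ext1
      · have := (ContinuousLinearMap.fst ℝ (Fin n → ℝ) (Fin p → ℝ)).intervalIntegral_comp_comm hi'
        simp only [ContinuousLinearMap.coe_fst', augmented] at this
        simp only [hZ, Prod.fst_add, augmented]
        rw [← this, hX _ hst]
      · have := (ContinuousLinearMap.snd ℝ (Fin n → ℝ) (Fin p → ℝ)).intervalIntegral_comp_comm hi'
        simp only [ContinuousLinearMap.coe_snd', augmented] at this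
        simp only [hZ, Prod.snd_add, augmented]
        rw [← this, intervalIntegral.integral_neg, sub_eq_add_neg]
  · rintro ⟨_, ⟨u, Z, hZ, rfl⟩, rfl⟩
    have hD : 0 ≤ T - t := sub_nonneg.2 htT
    have hi := hZ.integrable.comp_sub_right t
    rw [zero_add, sub_add_cancel] at hi
    have h0 : (0:ℝ) ∈ Set.Icc 0 (T - t) := ⟨le_rfl, hD⟩
    have hfi : IntervalIntegrable (fun r => f (Z (r - t)).1 (u (r - t))) volume t T :=
      ⟨hi.1.fst, hi.2.fst⟩
    have hLi : IntervalIntegrable (fun r => L (Z (r - t)).1 (u (r - t))) volume t T := by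
      have : IntervalIntegrable (fun r => -L (Z (r - t)).1 (u (r - t))) volume t T :=
        ⟨hi.1.snd, hi.2.snd⟩
      exact this.neg.congr fun r _ => neg_neg _
    refine ⟨fun s => u (s - t), fun s => (Z (s - t)).1, hZ.measurable.comp
      (measurable_id.sub_const t), fun s => hZ.mem _,
      fun s hs => hfi.mono_Icc ⟨le_rfl, htT⟩ hs, ?_, hLi, ?_⟩
    · intro s hs
      have hs' : s - t ∈ Set.Icc 0 (T - t) := ⟨by linarith [hs.1], by linarith [hs.2]⟩
      have h := (ContinuousLinearMap.fst ℝ (Fin n → ℝ) (Fin p → ℝ)).intervalIntegral_comp_comm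
        (hZ.integrable.mono_Icc h0 hs')
      simp only [ContinuousLinearMap.coe_fst', augmented] at h
      rw [intervalIntegral.integral_comp_sub_right (fun r => f (Z r).1 (u r)) t, sub_self, h]
      exact congrArg Prod.fst (hZ.eq _ hs')
    · have h := (ContinuousLinearMap.snd ℝ (Fin n → ℝ) (Fin p → ℝ)).intervalIntegral_comp_comm
        hZ.integrable
      simp only [ContinuousLinearMap.coe_snd', augmented, intervalIntegral.integral_neg] at h
      rw [intervalIntegral.integral_comp_sub_right (fun r => L (Z r).1 (u r)) t, sub_self]
      have h2 := congrArg Prod.snd (hZ.eq _ ⟨hD, le_rfl⟩)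
      simp only [Prod.snd_add, augmented] at h2
      rw [← h] at h2
      simp [h2]

section Kernel

variable {Kf KL Mf : ℝ} (hUne : U.Nonempty) (hKf : 0 ≤ Kf) (hMf : 0 < Mf)
  (hfLip : ∀ u ∈ U, ∀ x₁ x₂ : Fin n → ℝ, ‖f x₁ u - f x₂ u‖ ≤ Kf * ‖x₁ - x₂‖)
  (hLLip : ∀ u ∈ U, ∀ x₁ x₂ : Fin n → ℝ, ‖L x₁ u - L x₂ u‖ ≤ KL * ‖x₁ - x₂‖)
  (hfBdd : ∀ (x : Fin n → ℝ), ∀ u ∈ U, ‖f x u‖ ≤ Mf)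
  (hLBdd : ∀ (x : Fin n → ℝ), ∀ u ∈ U, ‖L x u‖ ≤ ML)

include hfLip hLLip hKf in
theorem norm_augmented_sub_le (u : Fin m → ℝ) (hu : u ∈ U) (q r : (Fin n → ℝ) × (Fin p → ℝ)) :
    ‖augmented f L q u - augmented f L r u‖ ≤ max Kf KL * ‖q - r‖ := by
  have h : ‖q.1 - r.1‖ ≤ ‖q - r‖ := norm_fst_le (q - r)
  have h0 : 0 ≤ max Kf KL := hKf.trans (le_max_left _ _)
  refine norm_prod_le_iff.2 ⟨?_, ?_⟩
  · calc _ ≤ Kf * ‖q.1 - r.1‖ := hfLip u hu _ _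
      _ ≤ _ := mul_le_mul (le_max_left _ _) h (norm_nonneg _) h0
  · simp only [augmented, Prod.snd_sub, neg_sub_neg]
    rw [norm_sub_rev]
    calc _ ≤ KL * ‖q.1 - r.1‖ := hLLip u hu _ _
      _ ≤ _ := mul_le_mul (le_max_right _ _) h (norm_nonneg _) h0

include hfBdd hLBdd in
theorem norm_augmented_le (q : (Fin n → ℝ) × (Fin p → ℝ)) (u : Fin m → ℝ) (hu : u ∈ U) :
    ‖augmented f L q u‖ ≤ max Mf ML := by
  refine norm_prod_le_iff.2 ⟨(hfBdd _ u hu).trans (le_max_left _ _), ?_⟩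
  simpa [augmented] using Or.inr (hLBdd q.1 u hu)

include hfBdd hLBdd in
theorem isCompact_closure_reach_augmented {D : ℝ} (hD : 0 ≤ D)
    (q : (Fin n → ℝ) × (Fin p → ℝ)) : IsCompact (closure (reach (augmented f L) U D q)) := by
  refine (Metric.isBounded_closedBall (x := q) (r := max Mf ML * D)).subset (fun y hy => ?_)
    |>.isCompact_closure
  rw [Metric.mem_closedBall, dist_eq_norm]
  exact norm_sub_le_of_mem_reach (norm_augmented_le hfBdd hLBdd) hD hy

include hfBdd hLBdd in
theorem closure_objSpace_eq (htT : t ≤ T) (x : Fin n → ℝ) (z : Fin p → ℝ) :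
    closure (objSpace f L U T t x) =
      (fun q => z - q.2) '' closure (reach (augmented f L) U (T - t) (x, z)) := by
  have hc : Continuous fun q : (Fin n → ℝ) × (Fin p → ℝ) => z - q.2 := by fun_prop
  rw [objSpace_eq_image_reach htT x z, image_closure_of_isCompact
    (isCompact_closure_reach_augmented hfBdd hLBdd (sub_nonneg.2 htT) _) hc.continuousOn]

include hUne hKf hMf hfLip hLLip hfBdd hLBdd

theorem mem_viabKernel_of_mem_returnFun_add {x : Fin n → ℝ} {z : Fin p → ℝ}
    (ht : t ∈ Set.Icc 0 T) (hz : z ∈ returnFun f L U T t x + orthant p) :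
    (t, x, z) ∈ viabKernel (phiMap T (FLset f L U (-1))) (Hset n p T ML) := by
  obtain ⟨v, ⟨hv, -⟩, o, ho, rfl⟩ := hz
  set D := T - t with hD
  have hD0 : 0 ≤ D := sub_nonneg.2 ht.2
  rw [closure_objSpace_eq hfBdd hLBdd ht.2 x (v + o)] at hv
  obtain ⟨e, he, hev⟩ := hv
  have heo : e.2 = o := by
    have h : v + o - e.2 = v := hev
    rw [sub_eq_iff_eq_add] at h
    exact (add_left_cancel h).symm
  have hM0 : 0 ≤ max Mf ML := hMf.le.trans (le_max_left _ _)
  obtain ⟨Y, hYL, hY0, hYD, hY⟩ := exists_relaxed_trajectory hUne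
    (hKf.trans (le_max_left _ _)) hM0 (norm_augmented_sub_le hKf hfLip hLLip)
    (norm_augmented_le hfBdd hLBdd) hD0 he
  set y : ℝ → ℝ × (Fin n → ℝ) × (Fin p → ℝ) := fun s => (min T (t + s), Y s) with hy
  have hyL := ((isometry_add_left t).lipschitz.const_min T).prodMk hYL
  have hy0 : y 0 = (t, x, v + o) := by simp [hy, hY0, ht.2]
  refine ⟨y, deriv y, hy0, fun s _ => (hyL.integral_deriv_eq_sub 0 s).1, fun s _ => ?_, ?_, ?_⟩
  · rw [(hyL.integral_deriv_eq_sub 0 s).2]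
    change y s = (t, x, v + o) + (y s - y 0)
    rw [hy0]
    abel
  · rw [ae_restrict_iff' measurableSet_Ici]
    filter_upwards [hY, hYL.ae_differentiableAt_real, Measure.ae_ne volume 0,
      Measure.ae_ne volume D] with s hs hsd hs0 hsD hs0'
    have hpos : 0 < s := lt_of_le_of_ne hs0' (Ne.symm hs0)
    rcases lt_or_gt_of_ne hsD with h | h
    · have hd : HasDerivAt y (1, deriv Y s) s := by
        refine (((hasDerivAt_id s).const_add t).prodMk hsd.hasDerivAt).congr_of_eventuallyEq ?_
        filter_upwards [Iio_mem_nhds h] with r hr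
        have : t + r ≤ T := by linarith [Set.mem_Iio.1 hr]
        simp [hy, this]
      have hlt : (y s).1 < T := (min_le_right _ _).trans_lt (by linarith)
      rw [hd.deriv, phiMap, if_pos hlt]
      refine ⟨rfl, ?_⟩
      rw [← velocitySet_augmented (Y s)]
      exact hs ⟨hpos, h⟩
    · have hd : HasDerivAt y 0 s := by
        refine (hasDerivAt_const s (T, e)).congr_of_eventuallyEq ?_
        filter_upwards [Ioi_mem_nhds h] with r hr
        have : T ≤ t + r := by linarith [Set.mem_Ioi.1 hr]
        simp [hy, this, hYD r (Set.mem_Ioi.1 hr).le]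
      have hge : ¬ (y s).1 < T := not_lt.2 (le_min le_rfl (by linarith))
      rw [hd.deriv, phiMap, if_neg hge]
      exact ⟨⟨le_rfl, zero_le_one⟩, subset_closure (subset_convexHull ℝ _ (Or.inr rfl))⟩
  · intro s hs
    refine ⟨⟨le_min (ht.1.trans ht.2) (by linarith [ht.1]), min_le_left _ _⟩, fun i => ?_⟩
    rcases le_total D s with h | h
    · have : T ≤ t + s := by linarith
      simpa [hy, this, hYD s h, heo] using ho i
    · have hts : t + s ≤ T := by linarith
      obtain ⟨hi, hint⟩ := hYL.integral_deriv_eq_sub s D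
      have h1 : ‖(Y D).2 - (Y s).2‖ ≤ ML * |D - s| := by
        have h2 := (ContinuousLinearMap.snd ℝ (Fin n → ℝ) (Fin p → ℝ)).intervalIntegral_comp_comm hi
        rw [hint, ContinuousLinearMap.coe_snd', Prod.snd_sub] at h2
        rw [← h2]
        refine intervalIntegral.norm_integral_le_of_norm_le_const_ae ?_
        filter_upwards [hY, Measure.ae_ne volume D] with r hr hrD hrs
        rw [Set.uIoc_of_le h] at hrs
        have := hr ⟨hs.trans_lt hrs.1, lt_of_le_of_ne hrs.2 hrD⟩
        rw [velocitySet_augmented] at this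
        exact norm_snd_le_of_mem_FLset hLBdd this
      rw [hYD D le_rfl, heo, abs_of_nonneg (by linarith)] at h1
      have h3 := (le_abs_self _).trans ((norm_le_pi_norm (o - (Y s).2) i).trans h1)
      simp only [Pi.sub_apply] at h3
      have h4 : 0 ≤ o i := ho i
      simp only [hy, min_eq_right hts]
      nlinarith

theorem mem_returnFun_add_of_mem_viabKernel {x : Fin n → ℝ} {z : Fin p → ℝ}
    (h : (t, x, z) ∈ viabKernel (phiMap T (FLset f L U (-1))) (Hset n p T ML)) :
    t ∈ Set.Icc 0 T ∧ z ∈ returnFun f L U T t x + orthant p := by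
  obtain ⟨y, g, hy0, hi, hy, hg, hH⟩ := h
  have ht : t ∈ Set.Icc 0 T := by simpa [hy0] using (hH 0 le_rfl).1
  refine ⟨ht, ?_⟩
  set D := T - t with hD
  have hD0 : 0 ≤ D := sub_nonneg.2 ht.2
  rw [ae_restrict_iff' measurableSet_Ici] at hg
  have hint₁ : ∀ s, 0 ≤ s → (y s).1 = t + ∫ r in (0:ℝ)..s, (g r).1 := by
    intro s hs
    have := (ContinuousLinearMap.fst ℝ ℝ ((Fin n → ℝ) × (Fin p → ℝ))).intervalIntegral_comp_comm
      (hi s hs)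
    simp only [ContinuousLinearMap.coe_fst'] at this
    rw [this, hy s hs, Prod.fst_add]
  have hint₂ : ∀ s, 0 ≤ s → (y s).2 = (x, z) + ∫ r in (0:ℝ)..s, (g r).2 := by
    intro s hs
    have := (ContinuousLinearMap.snd ℝ ℝ ((Fin n → ℝ) × (Fin p → ℝ))).intervalIntegral_comp_comm
      (hi s hs)
    simp only [ContinuousLinearMap.coe_snd'] at this
    rw [this, hy s hs, Prod.snd_add]
  have hg₁ : ∀ᵐ s, 0 ≤ s → ‖(g s).1‖ ≤ 1 := by
    filter_upwards [hg] with s hs hs0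
    have := hs hs0
    rw [phiMap] at this
    split_ifs at this
    · rw [Set.mem_singleton_iff.1 this.1, norm_one]
    · rw [Real.norm_of_nonneg this.1.1]
      exact this.1.2
  have hle : ∀ s, 0 ≤ s → (y s).1 ≤ t + s := by
    intro s hs
    have h1 : ‖∫ r in (0:ℝ)..s, (g r).1‖ ≤ 1 * |s - 0| := by
      refine intervalIntegral.norm_integral_le_of_norm_le_const_ae ?_
      filter_upwards [hg₁] with r hr hrs
      rw [Set.uIoc_of_le hs] at hrs
      exact hr hrs.1.le
    rw [one_mul, sub_zero, abs_of_nonneg hs] at h1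
    rw [hint₁ s hs]
    linarith [(le_abs_self _).trans h1]
  have hφ : ∀ᵐ s, s ∈ Set.Ioc 0 D → (g s).1 = 1 ∧ (g s).2 ∈ FLset f L U (-1) (y s).2.1 := by
    filter_upwards [hg, Measure.ae_ne volume D] with s hs hsD hs0
    have hlt : (y s).1 < T := by
      linarith [hle s hs0.1.le, lt_of_le_of_ne hs0.2 hsD]
    have := hs hs0.1.le
    rw [phiMap, if_pos hlt] at this
    exact this
  have hT : (y D).1 = T := by
    rw [hint₁ D hD0, intervalIntegral.integral_congr_ae (g := fun _ => (1:ℝ))]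
    · simp [hD]
    · rw [Set.uIoc_of_le hD0]
      filter_upwards [hφ] with s hs hsD using (hs hsD).1
  have hend : ∀ i, 0 ≤ (y D).2.2 i := by simpa [hT] using (hH D hD0).2
  have hmem := mem_closure_reach (D := D) (x := (x, z)) (y := fun s => (y s).2)
    (w := fun s => (g s).2) hUne (hKf.trans (le_max_left _ _))
    (hMf.le.trans (le_max_left _ _)) (norm_augmented_sub_le hKf hfLip hLLip)
    (norm_augmented_le hfBdd hLBdd) hD0 ⟨(hi D hD0).1.snd, (hi D hD0).2.snd⟩
    (fun s hs => hint₂ s hs.1) (by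
      filter_upwards [hφ] with s hs hsD
      rw [velocitySet_augmented]
      exact (hs hsD).2)
  have hcl := closure_objSpace_eq (T := T) hfBdd hLBdd ht.2 x z
  have hcompact : IsCompact (closure (objSpace f L U T t x)) := by
    rw [hcl]
    exact (isCompact_closure_reach_augmented hfBdd hLBdd hD0 _).image
      (continuous_const.sub continuous_snd)
  have hmem' : z - (y D).2.2 ∈ closure (objSpace f L U T t x) := by
    rw [hcl]
    exact ⟨_, hmem, rfl⟩
  obtain ⟨v, hv, hvc⟩ := exists_paretoE_le hcompact hmem'
  refine ⟨v, hv, z - v, fun i => ?_, add_sub_cancel _ _⟩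
  have h1 := hvc i
  have h2 := hend i
  simp only [Pi.sub_apply] at h1 ⊢
  linarith

end Kernel

end Augmented

/-- The epigraph of the set-valued return function `V` equals the viability kernel of
`H` for `φ`: `Epi(V) = Viab_φ(H)`. -/
theorem epigraph_eq_viabKernel {n m p : ℕ}
    (f : (Fin n → ℝ) → (Fin m → ℝ) → (Fin n → ℝ))
    (L : (Fin n → ℝ) → (Fin m → ℝ) → (Fin p → ℝ))
    (U : Set (Fin m → ℝ)) (hUne : U.Nonempty) (hUc : IsCompact U)
    (hf : ContinuousOn (fun q : (Fin n → ℝ) × (Fin m → ℝ) => f q.1 q.2) (Set.univ ×ˢ U))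
    (hL : ContinuousOn (fun q : (Fin n → ℝ) × (Fin m → ℝ) => L q.1 q.2) (Set.univ ×ˢ U))
    (Kf KL : ℝ) (hKf : 0 ≤ Kf) (hKL : 0 ≤ KL)
    (Mf ML : ℝ) (hMf : 0 < Mf) (hML : 0 ≤ ML)
    (hfLip : ∀ u ∈ U, ∀ x₁ x₂ : Fin n → ℝ, ‖f x₁ u - f x₂ u‖ ≤ Kf * ‖x₁ - x₂‖)
    (hLLip : ∀ u ∈ U, ∀ x₁ x₂ : Fin n → ℝ, ‖L x₁ u - L x₂ u‖ ≤ KL * ‖x₁ - x₂‖)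
    (hfBdd : ∀ (x : Fin n → ℝ), ∀ u ∈ U, ‖f x u‖ ≤ Mf)
    (hLBdd : ∀ (x : Fin n → ℝ), ∀ u ∈ U, ‖L x u‖ ≤ ML)
    (T : ℝ) (hT : 0 < T) :
    {q : ℝ × (Fin n → ℝ) × (Fin p → ℝ) |
        q.1 ∈ Set.Icc 0 T ∧ q.2.2 ∈ returnFun f L U T q.1 q.2.1 + orthant p} =
      viabKernel (phiMap T (FLset f L U (-1))) (Hset n p T ML) := by
  ext ⟨t, x, z⟩
  exact ⟨fun h => mem_viabKernel_of_mem_returnFun_add hUne hKf hMf hfLip hLLip hfBdd hLBdd h.1 h.2,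
    mem_returnFun_add_of_mem_viabKernel hUne hKf hMf hfLip hLLip hfBdd hLBdd⟩
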